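/- If u, v ∈ L^∞_loc(Ω) are nonnegative a.e. in Ω and are both subsolutions of −Δu + |u|^{q−1}u = 0, then the function x ↦ max(u(x), v(x)) is a subsolution of the same equation in Ω. -/

import Mathlib

open MeasureTheory Set Filter

noncomputable section

def laplacian {N : ℕ} (φ : EuclideanSpace ℝ (Fin N) → ℝ) (x : EuclideanSpace ℝ (Fin N)) : ℝ :=
  ∑ i : Fin N, iteratedFDeriv ℝ 2 φ x ![EuclideanSpace.single i 1, EuclideanSpace.single i 1]

def IsTestFun {N : ℕ} (Ω : Set (EuclideanSpace ℝ (Fin N))) (φ : EuclideanSpace ℝ (Fin N) → ℝ) : Prop :=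
  ContDiff ℝ (⊤ : ℕ∞) φ ∧ HasCompactSupport φ ∧ tsupport φ ⊆ Ω

def MemLqLoc {N : ℕ} (q : ℝ) (Ω : Set (EuclideanSpace ℝ (Fin N)))
    (u : EuclideanSpace ℝ (Fin N) → ℝ) : Prop :=
  AEStronglyMeasurable u (volume.restrict Ω) ∧
  ∀ K : Set (EuclideanSpace ℝ (Fin N)), K ⊆ Ω → IsCompact K →
    IntegrableOn (fun x => |u x| ^ q) K volume

def MemLinftyLoc {N : ℕ} (Ω : Set (EuclideanSpace ℝ (Fin N)))
    (u : EuclideanSpace ℝ (Fin N) → ℝ) : Prop :=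
  AEStronglyMeasurable u (volume.restrict Ω) ∧
  ∀ K : Set (EuclideanSpace ℝ (Fin N)), K ⊆ Ω → IsCompact K →
    ∃ M : ℝ, ∀ᵐ x ∂(volume.restrict K), |u x| ≤ M

def IsSubsolution {N : ℕ} (q : ℝ) (Ω : Set (EuclideanSpace ℝ (Fin N)))
    (u : EuclideanSpace ℝ (Fin N) → ℝ) : Prop :=
  MemLqLoc q Ω u ∧
  ∀ φ : EuclideanSpace ℝ (Fin N) → ℝ, IsTestFun Ω φ → (∀ x, 0 ≤ φ x) →
    (∫ x in Ω, (-(u x) * laplacian φ x + |u x| ^ (q - 1) * u x * φ x)) ≤ 0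

def IsSupersolution {N : ℕ} (q : ℝ) (Ω : Set (EuclideanSpace ℝ (Fin N)))
    (u : EuclideanSpace ℝ (Fin N) → ℝ) : Prop :=
  MemLqLoc q Ω u ∧
  ∀ φ : EuclideanSpace ℝ (Fin N) → ℝ, IsTestFun Ω φ → (∀ x, 0 ≤ φ x) →
    0 ≤ (∫ x in Ω, (-(u x) * laplacian φ x + |u x| ^ (q - 1) * u x * φ x))

def IsSolution {N : ℕ} (q : ℝ) (Ω : Set (EuclideanSpace ℝ (Fin N)))
    (u : EuclideanSpace ℝ (Fin N) → ℝ) : Prop :=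
  MemLqLoc q Ω u ∧
  ∀ φ : EuclideanSpace ℝ (Fin N) → ℝ, IsTestFun Ω φ →
    (∫ x in Ω, (-(u x) * laplacian φ x + |u x| ^ (q - 1) * u x * φ x)) = 0

lemma contDiff_fderiv_apply_const {N : ℕ} {f : EuclideanSpace ℝ (Fin N) → ℝ} {n m : WithTop ℕ∞}
    (hf : ContDiff ℝ n f) (hmn : m + 1 ≤ n) (e : EuclideanSpace ℝ (Fin N)) :
    ContDiff ℝ m (fun y => fderiv ℝ f y e) :=
  (hf.fderiv_right hmn).clm_apply contDiff_const

lemma laplacian_eq_sum_fderiv {N : ℕ} {f : EuclideanSpace ℝ (Fin N) → ℝ} (hf : ContDiff ℝ 2 f)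
    (x : EuclideanSpace ℝ (Fin N)) :
    laplacian f x = ∑ i, fderiv ℝ (fun y => fderiv ℝ f y (EuclideanSpace.single i 1)) x
      (EuclideanSpace.single i 1) := by
  refine Finset.sum_congr rfl fun i _ => ?_
  have hd : DifferentiableAt ℝ (fderiv ℝ f) x :=
    (hf.fderiv_right (m := 1) le_rfl).differentiable one_ne_zero x
  rw [iteratedFDeriv_two_apply, fderiv_clm_apply hd (differentiableAt_const _)]
  simp

lemma continuous_laplacian {N : ℕ} {f : EuclideanSpace ℝ (Fin N) → ℝ} (hf : ContDiff ℝ 2 f) :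
    Continuous (laplacian f) := by
  rw [funext (laplacian_eq_sum_fderiv hf)]
  refine continuous_finsetSum _ fun i _ => ?_
  exact (contDiff_fderiv_apply_const (m := 0)
    (contDiff_fderiv_apply_const (m := 1) hf le_rfl _) (by simp) _).continuous

lemma laplacian_eq_zero_of_notMem_tsupport {N : ℕ} {f : EuclideanSpace ℝ (Fin N) → ℝ}
    {x : EuclideanSpace ℝ (Fin N)} (hx : x ∉ tsupport f) : laplacian f x = 0 := by
  have h : iteratedFDeriv ℝ 2 f x = 0 := by
    by_contra h
    exact hx (support_iteratedFDeriv_subset 2 h)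
  simp [laplacian, h]

lemma hasCompactSupport_laplacian {N : ℕ} {f : EuclideanSpace ℝ (Fin N) → ℝ}
    (hf : HasCompactSupport f) : HasCompactSupport (laplacian f) :=
  HasCompactSupport.intro hf fun _ hx => laplacian_eq_zero_of_notMem_tsupport hx

lemma integral_mul_laplacian {N : ℕ} {g φ : EuclideanSpace ℝ (Fin N) → ℝ} (hg : ContDiff ℝ 2 g)
    (hφ : ContDiff ℝ 2 φ) (hc : HasCompactSupport φ) :
    ∫ x, g x * laplacian φ x = ∫ x, laplacian g x * φ x := by
  have hg1 := fun e => contDiff_fderiv_apply_const (m := 1) hg le_rfl e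
  have hφ1 := fun e => contDiff_fderiv_apply_const (m := 1) hφ le_rfl e
  have hg2 := fun e => contDiff_fderiv_apply_const (m := 0) (hg1 e) (by simp) e
  have hφ2 := fun e => contDiff_fderiv_apply_const (m := 0) (hφ1 e) (by simp) e
  have hc1 := fun e => hc.fderiv_apply (𝕜 := ℝ) e
  have hc2 := fun e => (hc1 e).fderiv_apply (𝕜 := ℝ) e
  have int : ∀ {a b : EuclideanSpace ℝ (Fin N) → ℝ}, Continuous a → Continuous b →
      HasCompactSupport b → Integrable (fun x => a x * b x) := fun ha hb h =>
    (ha.mul hb).integrable_of_hasCompactSupport (h.mul_left (f := _))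
  simp only [laplacian_eq_sum_fderiv hg, laplacian_eq_sum_fderiv hφ, Finset.mul_sum,
    Finset.sum_mul]
  rw [integral_finsetSum _ fun i _ => int hg.continuous (hφ2 _).continuous (hc2 _),
    integral_finsetSum _ fun i _ => int (hg2 _).continuous hφ.continuous hc]
  refine Finset.sum_congr rfl fun i _ => ?_
  generalize (EuclideanSpace.single i 1 : EuclideanSpace ℝ (Fin N)) = e
  rw [integral_mul_fderiv_eq_neg_fderiv_mul_of_integrable
      (int (hg1 e).continuous (hφ1 e).continuous (hc1 e))
      (int hg.continuous (hφ2 e).continuous (hc2 e))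
      (int hg.continuous (hφ1 e).continuous (hc1 e))
      (fun x _ => hg.differentiable two_ne_zero x)
      (fun x _ => (hφ1 e).differentiable one_ne_zero x),
    integral_mul_fderiv_eq_neg_fderiv_mul_of_integrable
      (int (hg2 e).continuous hφ.continuous hc)
      (int (hg1 e).continuous (hφ1 e).continuous (hc1 e))
      (int (hg1 e).continuous hφ.continuous hc)
      (fun x _ => (hg1 e).differentiable one_ne_zero x)
      (fun x _ => hφ.differentiable two_ne_zero x), neg_neg]

lemma laplacian_add {N : ℕ} {f g : EuclideanSpace ℝ (Fin N) → ℝ} (hf : ContDiff ℝ 2 f)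
    (hg : ContDiff ℝ 2 g) (x : EuclideanSpace ℝ (Fin N)) :
    laplacian (fun y => f y + g y) x = laplacian f x + laplacian g x := by
  simp only [laplacian, ← Finset.sum_add_distrib]
  refine Finset.sum_congr rfl fun i _ => ?_
  rw [fun_iteratedFDeriv_add_apply hf.contDiffAt hg.contDiffAt]
  rfl

lemma laplacian_sub {N : ℕ} {f g : EuclideanSpace ℝ (Fin N) → ℝ} (hf : ContDiff ℝ 2 f)
    (hg : ContDiff ℝ 2 g) (x : EuclideanSpace ℝ (Fin N)) :
    laplacian (fun y => f y - g y) x = laplacian f x - laplacian g x := by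
  have h := laplacian_add (hf.sub hg) hg x
  simp only [sub_add_cancel] at h
  exact eq_sub_of_add_eq h.symm

lemma deriv_mul_laplacian_le_laplacian_comp {N : ℕ} {h : ℝ → ℝ}
    {w : EuclideanSpace ℝ (Fin N) → ℝ} (hh : ContDiff ℝ 2 h)
    (hconv : ∀ t, 0 ≤ deriv (deriv h) t) (hw : ContDiff ℝ 2 w) (x : EuclideanSpace ℝ (Fin N)) :
    deriv h (w x) * laplacian w x ≤ laplacian (fun y => h (w y)) x := by
  rw [laplacian_eq_sum_fderiv hw, laplacian_eq_sum_fderiv (f := fun y => h (w y)) (hh.comp hw),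
    Finset.mul_sum]
  refine Finset.sum_le_sum fun i _ => ?_
  generalize (EuclideanSpace.single i 1 : EuclideanSpace ℝ (Fin N)) = e
  have hwd := hw.differentiable two_ne_zero
  have hh1 : ContDiff ℝ 1 (deriv h) := ((contDiff_succ_iff_deriv (n := 1)).1 hh).2.2
  have hw1 := contDiff_fderiv_apply_const (m := 1) hw le_rfl e
  have key : (fun y => fderiv ℝ (fun y => h (w y)) y e)
      = fun y => deriv h (w y) * fderiv ℝ w y e := by
    ext y
    have := ((hh.differentiable two_ne_zero (w y)).hasDerivAt.comp_hasFDerivAt y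
      (hwd y).hasFDerivAt).fderiv
    simp only [Function.comp_def] at this
    rw [this]; simp
  have h1 := (hh1.differentiable one_ne_zero (w x)).hasDerivAt.comp_hasFDerivAt x
      (hwd x).hasFDerivAt
  have h2 := (h1.mul (hw1.differentiable one_ne_zero x).hasFDerivAt).fderiv
  have h3 : fderiv ℝ (fun y => fderiv ℝ (fun y => h (w y)) y e) x e
      = deriv h (w x) * fderiv ℝ (fun y => fderiv ℝ w y e) x e
        + fderiv ℝ w x e * (deriv (deriv h) (w x) * fderiv ℝ w x e) := by
    rw [key]
    refine (congrArg (fun L => L e) h2).trans ?_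
    simp
  rw [h3]
  nlinarith [mul_nonneg (hconv (w x)) (sq_nonneg (fderiv ℝ w x e))]

open scoped Convolution Topology

open ContinuousLinearMap (lsmul)

lemma fderiv_convolution_apply {N : ℕ} {ρ g : EuclideanSpace ℝ (Fin N) → ℝ} (hρ : ContDiff ℝ 1 ρ)
    (hc : HasCompactSupport ρ) (hg : LocallyIntegrable g) (e x : EuclideanSpace ℝ (Fin N)) :
    fderiv ℝ (ρ ⋆[lsmul ℝ ℝ, volume] g) x e
      = ((fun y => fderiv ℝ ρ y e) ⋆[lsmul ℝ ℝ, volume] g) x := by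
  have hex := (hc.fderiv (𝕜 := ℝ)).convolutionExists_left
    ((lsmul ℝ ℝ : ℝ →L[ℝ] ℝ →L[ℝ] ℝ).precompL (EuclideanSpace ℝ (Fin N)))
    (hρ.continuous_fderiv one_ne_zero) hg x
  rw [(hc.hasFDerivAt_convolution_left (lsmul ℝ ℝ) hρ hg x).fderiv, convolution, convolution,
    ContinuousLinearMap.integral_apply hex]
  rfl

lemma laplacian_convolution {N : ℕ} {ρ g : EuclideanSpace ℝ (Fin N) → ℝ} (hρ : ContDiff ℝ 2 ρ)
    (hc : HasCompactSupport ρ) (hg : LocallyIntegrable g) (x : EuclideanSpace ℝ (Fin N)) :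
    laplacian (ρ ⋆[lsmul ℝ ℝ, volume] g) x = ∫ t, g t * laplacian ρ (x - t) := by
  have hρ1 := fun e => contDiff_fderiv_apply_const (m := 1) hρ le_rfl e
  have hρ2 := fun e => contDiff_fderiv_apply_const (m := 0) (hρ1 e) (by simp) e
  have hc1 := fun e => hc.fderiv_apply (𝕜 := ℝ) e
  have hc2 := fun e => (hc1 e).fderiv_apply (𝕜 := ℝ) e
  have hcd : ContDiff ℝ 2 (ρ ⋆[lsmul ℝ ℝ, volume] g) :=
    hc.contDiff_convolution_left (n := 2) (lsmul ℝ ℝ) hρ hg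
  simp only [laplacian_eq_sum_fderiv hcd, laplacian_eq_sum_fderiv hρ, Finset.mul_sum]
  have hex : ∀ e, Integrable fun t => g t *
      fderiv ℝ (fun y => fderiv ℝ ρ y e) (x - t) e := fun e => by
    have := ((hc2 e).convolutionExists_left (lsmul ℝ ℝ) (hρ2 e).continuous hg x).integrable_swap
    simpa [mul_comm] using this
  rw [integral_finsetSum _ fun i _ => hex _]
  refine Finset.sum_congr rfl fun i _ => ?_
  generalize (EuclideanSpace.single i 1 : EuclideanSpace ℝ (Fin N)) = e
  rw [funext fun y => fderiv_convolution_apply (hρ.of_le one_le_two) hc hg e y,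
    fderiv_convolution_apply (hρ1 e) (hc1 e) hg, convolution_eq_swap]
  simp [mul_comm]

lemma laplacian_comp_const_sub {N : ℕ} {ρ : EuclideanSpace ℝ (Fin N) → ℝ} (hρ : ContDiff ℝ 2 ρ)
    (x y : EuclideanSpace ℝ (Fin N)) :
    laplacian (fun t => ρ (x - t)) y = laplacian ρ (x - y) := by
  have key : ∀ {f : EuclideanSpace ℝ (Fin N) → ℝ}, Differentiable ℝ f → ∀ z e,
      fderiv ℝ (fun t => f (x - t)) z e = -fderiv ℝ f (x - z) e := fun {f} hf z e => by
    have := ((hf (x - z)).hasFDerivAt.comp z ((hasFDerivAt_id z).const_sub x)).fderiv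
    refine (congrArg (fun L => L e) this).trans ?_
    simp
  rw [laplacian_eq_sum_fderiv hρ,
    laplacian_eq_sum_fderiv (f := fun t => ρ (x - t)) (hρ.comp (contDiff_const.sub contDiff_id))]
  refine Finset.sum_congr rfl fun i _ => ?_
  generalize (EuclideanSpace.single i 1 : EuclideanSpace ℝ (Fin N)) = e
  rw [funext fun z => key (hρ.differentiable two_ne_zero) z e]
  have h1 := (contDiff_fderiv_apply_const (m := 1) hρ le_rfl e).differentiable one_ne_zero
  have := key h1.neg y e
  simp only [Pi.neg_apply] at this
  rw [this, fderiv_neg]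
  simp

lemma abs_convolution_normed_le {N : ℕ} (ρ : ContDiffBump (0 : EuclideanSpace ℝ (Fin N)))
    {g : EuclideanSpace ℝ (Fin N) → ℝ} {M : ℝ} (hg : ∀ᵐ x, |g x| ≤ M)
    (x : EuclideanSpace ℝ (Fin N)) :
    |(ρ.normed volume ⋆[lsmul ℝ ℝ, volume] g) x| ≤ M := by
  rw [convolution_eq_swap, ← Real.norm_eq_abs]
  have hi : Integrable (fun t => M * ρ.normed volume (x - t)) :=
    (ρ.integrable_normed.comp_sub_left x).const_mul M
  refine (norm_integral_le_of_norm_le hi ?_).trans ?_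
  · filter_upwards [hg] with t ht
    simp only [ContinuousLinearMap.lsmul_apply, smul_eq_mul, norm_mul, Real.norm_eq_abs,
      abs_of_nonneg (ρ.nonneg_normed (μ := volume) _)]
    rw [mul_comm]
    exact mul_le_mul_of_nonneg_right ht (ρ.nonneg_normed _)
  · rw [integral_const_mul, integral_sub_left_eq_self (ρ.normed volume) volume x,
      ρ.integral_normed, mul_one]

lemma contDiff_sqrt_sq_add {δ : ℝ} (hδ : 0 < δ) {n : WithTop ℕ∞} :
    ContDiff ℝ n (fun t : ℝ => √(t ^ 2 + δ)) :=
  ((contDiff_id.pow 2).add contDiff_const).sqrt fun t => by positivity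

lemma deriv_sqrt_sq_add {δ : ℝ} (hδ : 0 < δ) :
    deriv (fun t : ℝ => √(t ^ 2 + δ)) = fun t => t / √(t ^ 2 + δ) := by
  ext t
  have h := (((hasDerivAt_id t).pow 2).add_const δ).sqrt (by simp; positivity)
  refine HasDerivAt.deriv (h.congr_deriv ?_)
  simp only [id, Pi.pow_apply]
  field_simp
  simp

lemma deriv_deriv_sqrt_sq_add_nonneg {δ : ℝ} (hδ : 0 < δ) (t : ℝ) :
    0 ≤ deriv (deriv (fun t : ℝ => √(t ^ 2 + δ))) t := by
  have hs : 0 < √(t ^ 2 + δ) := Real.sqrt_pos.2 (by positivity)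
  have h1 : HasDerivAt (fun t : ℝ => √(t ^ 2 + δ)) (t / √(t ^ 2 + δ)) t := by
    have := ((contDiff_sqrt_sq_add hδ (n := 1)).differentiable one_ne_zero t).hasDerivAt
    rwa [deriv_sqrt_sq_add hδ] at this
  have h2 := (hasDerivAt_id t).div h1 hs.ne'
  rw [deriv_sqrt_sq_add hδ]
  refine h2.deriv.symm ▸ ?_
  refine div_nonneg ?_ (sq_nonneg _)
  simp only [id, one_mul]
  rw [sub_nonneg, mul_div_assoc', div_le_iff₀ hs, Real.mul_self_sqrt (by positivity)]
  nlinarith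

lemma abs_div_sqrt_sq_add_le_one {δ : ℝ} (hδ : 0 < δ) (t : ℝ) : |t / √(t ^ 2 + δ)| ≤ 1 := by
  rw [abs_div, abs_of_nonneg (Real.sqrt_nonneg _)]
  exact div_le_one_of_le₀ (Real.abs_le_sqrt (by linarith)) (Real.sqrt_nonneg _)

lemma integral_mul_le_integral_mul_laplacian {N : ℕ} {U V F G φ : EuclideanSpace ℝ (Fin N) → ℝ}
    {δ : ℝ} (hδ : 0 < δ) (hU : ContDiff ℝ 2 U) (hV : ContDiff ℝ 2 V) (hF : Continuous F)
    (hG : Continuous G) (hφ : ContDiff ℝ 2 φ) (hc : HasCompactSupport φ) (hφ0 : ∀ x, 0 ≤ φ x)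
    (hFU : ∀ x ∈ tsupport φ, F x ≤ laplacian U x) (hGV : ∀ x ∈ tsupport φ, G x ≤ laplacian V x) :
    ∫ x, (F x + G x + (U x - V x) / √((U x - V x) ^ 2 + δ) * (F x - G x)) * φ x
      ≤ ∫ x, (U x + V x + √((U x - V x) ^ 2 + δ)) * laplacian φ x := by
  have hUV : ContDiff ℝ 2 fun y => U y - V y := hU.sub hV
  have hs : ContDiff ℝ 2 fun y => √((U y - V y) ^ 2 + δ) := (contDiff_sqrt_sq_add hδ).comp hUV
  have hJ : ContDiff ℝ 2 fun y => (U y + V y) + √((U y - V y) ^ 2 + δ) := (hU.add hV).add hs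
  have hpos : ∀ x, 0 < √((U x - V x) ^ 2 + δ) := fun x => Real.sqrt_pos.2 (by positivity)
  rw [integral_mul_laplacian hJ hφ hc]
  refine integral_mono ?_ ?_ fun x => ?_
  · refine Continuous.integrable_of_hasCompactSupport ?_ hc.mul_left
    refine Continuous.mul ?_ hφ.continuous
    exact (hF.add hG).add ((hUV.continuous.div hs.continuous fun x => (hpos x).ne').mul
      (hF.sub hG))
  · exact ((continuous_laplacian hJ).mul hφ.continuous).integrable_of_hasCompactSupport hc.mul_left
  · by_cases hx : x ∈ tsupport φ
    · refine mul_le_mul_of_nonneg_right ?_ (hφ0 x)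
      have h1 := deriv_mul_laplacian_le_laplacian_comp (contDiff_sqrt_sq_add hδ)
        (deriv_deriv_sqrt_sq_add_nonneg hδ) hUV x
      rw [deriv_sqrt_sq_add hδ, laplacian_sub hU hV] at h1
      rw [laplacian_add (f := fun y => U y + V y) (hU.add hV) hs, laplacian_add hU hV]
      have h2 := abs_le.1 (abs_div_sqrt_sq_add_le_one hδ (U x - V x))
      simp only at h1 h2
      nlinarith [mul_nonneg (sub_nonneg.2 (hFU x hx)) (by linarith : 0 ≤ 1 +
        (U x - V x) / √((U x - V x) ^ 2 + δ)), mul_nonneg (sub_nonneg.2 (hGV x hx))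
        (by linarith : 0 ≤ 1 - (U x - V x) / √((U x - V x) ^ 2 + δ))]
    · simp [image_eq_zero_of_notMem_tsupport hx]

lemma tendsto_div_sqrt_mul_sub {f : ℝ → ℝ} (hf : Monotone f) {a b : ℝ} {U V F G δ : ℕ → ℝ}
    (hU : Tendsto U atTop (𝓝 a)) (hV : Tendsto V atTop (𝓝 b)) (hF : Tendsto F atTop (𝓝 (f a)))
    (hG : Tendsto G atTop (𝓝 (f b))) (hδ : Tendsto δ atTop (𝓝 0)) (hδ0 : ∀ n, 0 < δ n) :
    Tendsto (fun n => F n + G n + (U n - V n) / √((U n - V n) ^ 2 + δ n) * (F n - G n)) atTop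
      (𝓝 (2 * f (max a b))) := by
  have key : Tendsto (fun n => (U n - V n) / √((U n - V n) ^ 2 + δ n) * (F n - G n)) atTop
      (𝓝 (|f a - f b|)) := by
    rcases eq_or_ne a b with rfl | hab
    · rw [sub_self, abs_zero]
      have h0 : Tendsto (fun n => F n - G n) atTop (𝓝 0) := by simpa using hF.sub hG
      refine squeeze_zero_norm (fun n => ?_) (by simpa using h0.norm)
      rw [norm_mul]
      exact mul_le_of_le_one_left (norm_nonneg _) (abs_div_sqrt_sq_add_le_one (hδ0 n) _)
    · have hs : Tendsto (fun n => √((U n - V n) ^ 2 + δ n)) atTop (𝓝 |a - b|) := by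
        simpa [Real.sqrt_sq_eq_abs] using (((hU.sub hV).pow 2).add hδ).sqrt
      have hne : |a - b| ≠ 0 := abs_ne_zero.2 (sub_ne_zero.2 hab)
      suffices hsign : |f a - f b| = (a - b) / |a - b| * (f a - f b) by
        rw [hsign]
        exact ((hU.sub hV).div hs hne).mul (hF.sub hG)
      rcases lt_or_gt_of_ne hab with h | h
      · rw [abs_of_neg (sub_neg.2 h), abs_of_nonpos (sub_nonpos.2 (hf h.le)), div_neg,
          div_self (sub_ne_zero.2 hab)]
        ring
      · rw [abs_of_pos (sub_pos.2 h), abs_of_nonneg (sub_nonneg.2 (hf h.le)),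
          div_self (sub_ne_zero.2 hab), one_mul]
  convert (hF.add hG).add key using 2
  rcases le_total a b with h | h
  · rw [max_eq_right h, abs_of_nonpos (sub_nonpos.2 (hf h))]
    ring
  · rw [max_eq_left h, abs_of_nonneg (sub_nonneg.2 (hf h))]
    ring

lemma locallyIntegrable_of_ae_abs_le {N : ℕ} {g : EuclideanSpace ℝ (Fin N) → ℝ} {M : ℝ}
    (hg : AEStronglyMeasurable g) (hM : ∀ᵐ x, |g x| ≤ M) : LocallyIntegrable g :=
  (locallyIntegrable_const M).mono hg (hM.mono fun _ hx => hx.trans (le_abs_self M))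

lemma integral_comp_max_le_of_mollified {N : ℕ} {f : ℝ → ℝ} (hf : Monotone f)
    {a b φ : EuclideanSpace ℝ (Fin N) → ℝ} {M r : ℝ} (hr : 0 < r)
    (ha : AEStronglyMeasurable a) (hb : AEStronglyMeasurable b)
    (haM : ∀ᵐ x, |a x| ≤ M) (hbM : ∀ᵐ x, |b x| ≤ M)
    (hφ : ContDiff ℝ 2 φ) (hc : HasCompactSupport φ) (hφ0 : ∀ x, 0 ≤ φ x)
    (hasub : ∀ x ∈ tsupport φ, ∀ ρ : ContDiffBump (0 : EuclideanSpace ℝ (Fin N)), ρ.rOut ≤ r →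
      (ρ.normed volume ⋆[lsmul ℝ ℝ, volume] fun y => f (a y)) x
        ≤ laplacian (ρ.normed volume ⋆[lsmul ℝ ℝ, volume] a) x)
    (hbsub : ∀ x ∈ tsupport φ, ∀ ρ : ContDiffBump (0 : EuclideanSpace ℝ (Fin N)), ρ.rOut ≤ r →
      (ρ.normed volume ⋆[lsmul ℝ ℝ, volume] fun y => f (b y)) x
        ≤ laplacian (ρ.normed volume ⋆[lsmul ℝ ℝ, volume] b) x) :
    ∫ x, f (max (a x) (b x)) * φ x ≤ ∫ x, max (a x) (b x) * laplacian φ x := by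
  have hbound : ∀ t, |t| ≤ M → |f t| ≤ |f M| + |f (-M)| := fun t ht => by
    have h1 := hf (abs_le.1 ht).1
    have h2 := hf (abs_le.1 ht).2
    rw [abs_le]
    constructor
    · linarith [neg_abs_le (f (-M)), abs_nonneg (f M)]
    · linarith [le_abs_self (f M), abs_nonneg (f (-M))]
  have hfa : AEStronglyMeasurable fun y => f (a y) :=
    (hf.measurable.comp_aemeasurable ha.aemeasurable).aestronglyMeasurable
  have hfb : AEStronglyMeasurable fun y => f (b y) :=
    (hf.measurable.comp_aemeasurable hb.aemeasurable).aestronglyMeasurable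
  have hfaM : ∀ᵐ x, |f (a x)| ≤ |f M| + |f (-M)| := haM.mono fun x hx => hbound _ hx
  have hfbM : ∀ᵐ x, |f (b x)| ≤ |f M| + |f (-M)| := hbM.mono fun x hx => hbound _ hx
  generalize |f M| + |f (-M)| = C at hfaM hfbM
  have hai := locallyIntegrable_of_ae_abs_le ha haM
  have hbi := locallyIntegrable_of_ae_abs_le hb hbM
  have hfai := locallyIntegrable_of_ae_abs_le hfa hfaM
  have hfbi := locallyIntegrable_of_ae_abs_le hfb hfbM
  let δ : ℕ → ℝ := fun n => 1 / ((n : ℝ) + 1)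
  have hδ0 : ∀ n, 0 < δ n := fun n => by positivity
  have hδ1 : ∀ n, δ n ≤ 1 := fun n =>
    div_le_one_of_le₀ (by linarith [Nat.cast_nonneg (α := ℝ) n]) (by positivity)
  have hδ : Tendsto δ atTop (𝓝 0) := tendsto_one_div_add_atTop_nhds_zero_nat
  let ρ : ℕ → ContDiffBump (0 : EuclideanSpace ℝ (Fin N)) := fun n =>
    ⟨r * δ n / 2, r * δ n, half_pos (mul_pos hr (hδ0 n)), half_lt_self (mul_pos hr (hδ0 n))⟩
  have hρ : Tendsto (fun n => (ρ n).rOut) atTop (𝓝 0) := by simpa using hδ.const_mul r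
  have hρ2 : ∀ᶠ n in atTop, (ρ n).rOut ≤ 2 * (ρ n).rIn :=
    Eventually.of_forall fun n => (mul_div_cancel₀ (r * δ n) two_ne_zero).symm.le
      |>.trans (by simp only [ρ]; linarith)
  have hρr : ∀ n, (ρ n).rOut ≤ r := fun n => mul_le_of_le_one_right hr.le (hδ1 n)
  have hsm : ∀ {g : EuclideanSpace ℝ (Fin N) → ℝ}, LocallyIntegrable g → ∀ n,
      ContDiff ℝ 2 ((ρ n).normed volume ⋆[lsmul ℝ ℝ, volume] g) := fun hg n =>
    (ρ n).hasCompactSupport_normed.contDiff_convolution_left (n := 2) (lsmul ℝ ℝ)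
      (ρ n).contDiff_normed hg
  have hstep := fun n => integral_mul_le_integral_mul_laplacian (hδ0 n) (hsm hai n) (hsm hbi n)
    (hsm hfai n).continuous (hsm hfbi n).continuous hφ hc hφ0
    (fun x hx => hasub x hx (ρ n) (hρr n)) (fun x hx => hbsub x hx (ρ n) (hρr n))
  have hta := ContDiffBump.ae_convolution_tendsto_right_of_locallyIntegrable hρ hρ2 hai
  have htb := ContDiffBump.ae_convolution_tendsto_right_of_locallyIntegrable hρ hρ2 hbi
  have htfa := ContDiffBump.ae_convolution_tendsto_right_of_locallyIntegrable hρ hρ2 hfai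
  have htfb := ContDiffBump.ae_convolution_tendsto_right_of_locallyIntegrable hρ hρ2 hfbi
  have hUM := fun n => abs_convolution_normed_le (ρ n) haM
  have hVM := fun n => abs_convolution_normed_le (ρ n) hbM
  have hFC := fun n => abs_convolution_normed_le (ρ n) hfaM
  have hGC := fun n => abs_convolution_normed_le (ρ n) hfbM
  have hpos : ∀ n t, 0 < √(t ^ 2 + δ n) := fun n t =>
    Real.sqrt_pos.2 (add_pos_of_nonneg_of_pos (sq_nonneg t) (hδ0 n))
  have hlim1 := tendsto_integral_of_dominated_convergence (μ := volume)
    (F := fun n x => (((ρ n).normed volume ⋆[lsmul ℝ ℝ, volume] fun y => f (a y)) x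
      + ((ρ n).normed volume ⋆[lsmul ℝ ℝ, volume] fun y => f (b y)) x
      + (((ρ n).normed volume ⋆[lsmul ℝ ℝ, volume] a) x
        - ((ρ n).normed volume ⋆[lsmul ℝ ℝ, volume] b) x)
        / √((((ρ n).normed volume ⋆[lsmul ℝ ℝ, volume] a) x
          - ((ρ n).normed volume ⋆[lsmul ℝ ℝ, volume] b) x) ^ 2 + δ n)
        * (((ρ n).normed volume ⋆[lsmul ℝ ℝ, volume] fun y => f (a y)) x
          - ((ρ n).normed volume ⋆[lsmul ℝ ℝ, volume] fun y => f (b y)) x)) * φ x)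
    (f := fun x => 2 * f (max (a x) (b x)) * φ x) (fun x => (C + C + (C + C)) * |φ x|)
    (fun n => Continuous.aestronglyMeasurable (((((hsm hfai n).continuous.add
      (hsm hfbi n).continuous).add ((((hsm hai n).sub (hsm hbi n)).continuous.div
      ((((hsm hai n).sub (hsm hbi n)).continuous.pow 2).add_const (δ n)).sqrt
      fun x => (hpos n _).ne').mul ((hsm hfai n).sub (hsm hfbi n)).continuous)).mul
      hφ.continuous)))
    ((hφ.continuous.abs.integrable_of_hasCompactSupport hc.norm).const_mul _)
    (fun n => Eventually.of_forall fun x => by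
      simp only [Real.norm_eq_abs, abs_mul]
      refine mul_le_mul_of_nonneg_right ?_ (abs_nonneg _)
      refine (abs_add_le _ _).trans (add_le_add ((abs_add_le _ _).trans
        (add_le_add (hFC n x) (hGC n x))) ?_)
      rw [abs_mul]
      exact (mul_le_of_le_one_left (abs_nonneg _) (abs_div_sqrt_sq_add_le_one (hδ0 n) _)).trans
        ((abs_sub _ _).trans (add_le_add (hFC n x) (hGC n x))))
    (by
      filter_upwards [hta, htb, htfa, htfb] with x h1 h2 h3 h4
      exact (tendsto_div_sqrt_mul_sub hf h1 h2 h3 h4 hδ hδ0).mul_const _)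
  have hlim2 := tendsto_integral_of_dominated_convergence (μ := volume)
    (F := fun n x => (((ρ n).normed volume ⋆[lsmul ℝ ℝ, volume] a) x
      + ((ρ n).normed volume ⋆[lsmul ℝ ℝ, volume] b) x
      + √((((ρ n).normed volume ⋆[lsmul ℝ ℝ, volume] a) x
      - ((ρ n).normed volume ⋆[lsmul ℝ ℝ, volume] b) x) ^ 2 + δ n)) * laplacian φ x)
    (f := fun x => 2 * max (a x) (b x) * laplacian φ x)
    (fun x => (M + M + √((M + M) ^ 2 + 1)) * |laplacian φ x|)
    (fun n => Continuous.aestronglyMeasurable ((((hsm hai n).continuous.add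
      (hsm hbi n).continuous).add ((((hsm hai n).sub (hsm hbi n)).continuous.pow 2).add_const
      (δ n)).sqrt).mul (continuous_laplacian hφ)))
    (((continuous_laplacian hφ).abs.integrable_of_hasCompactSupport
      (hasCompactSupport_laplacian hc).norm).const_mul _)
    (fun n => Eventually.of_forall fun x => by
      simp only [Real.norm_eq_abs, abs_mul]
      refine mul_le_mul_of_nonneg_right ?_ (abs_nonneg _)
      refine (abs_add_le _ _).trans (add_le_add ((abs_add_le _ _).trans
        (add_le_add (hUM n x) (hVM n x))) ?_)
      rw [abs_of_nonneg (Real.sqrt_nonneg _)]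
      refine Real.sqrt_le_sqrt (add_le_add ?_ (hδ1 n))
      rw [← sq_abs]
      exact pow_le_pow_left₀ (abs_nonneg _)
        ((abs_sub _ _).trans (add_le_add (hUM n x) (hVM n x))) 2)
    (by
      filter_upwards [hta, htb] with x h1 h2
      refine Tendsto.mul_const _ ?_
      convert (h1.add h2).add (((h1.sub h2).pow 2).add hδ).sqrt using 2
      rw [add_zero, Real.sqrt_sq_eq_abs]
      rcases le_total (a x) (b x) with h | h
      · rw [max_eq_right h, abs_of_nonpos (sub_nonpos.2 h)]
        ring
      · rw [max_eq_left h, abs_of_nonneg (sub_nonneg.2 h)]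
        ring)
  have := le_of_tendsto_of_tendsto' hlim1 hlim2 hstep
  simp only [mul_assoc, integral_const_mul] at this
  linarith

lemma monotone_abs_rpow_mul_self {q : ℝ} (hq : 1 ≤ q) : Monotone fun t : ℝ => |t| ^ (q - 1) * t := by
  have hpos : ∀ {s t : ℝ}, 0 ≤ s → s ≤ t → |s| ^ (q - 1) * s ≤ |t| ^ (q - 1) * t := fun hs hst => by
    rw [abs_of_nonneg hs, abs_of_nonneg (hs.trans hst)]
    have := Real.rpow_le_rpow hs hst (sub_nonneg.2 hq)
    exact mul_le_mul this hst hs (Real.rpow_nonneg (hs.trans hst) _)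
  intro s t hst
  rcases le_total 0 s with hs | hs
  · exact hpos hs hst
  rcases le_total 0 t with ht | ht
  · exact (mul_nonpos_of_nonneg_of_nonpos (by positivity) hs).trans (by positivity)
  · have := hpos (neg_nonneg.2 ht) (neg_le_neg hst)
    simp only [abs_neg, mul_neg] at this
    exact neg_le_neg_iff.1 this

lemma setIntegral_weakForm_eq {N : ℕ} {q M : ℝ} (hq : 1 ≤ q)
    {Ω K : Set (EuclideanSpace ℝ (Fin N))} {u ψ : EuclideanSpace ℝ (Fin N) → ℝ} (hKΩ : K ⊆ Ω)
    (hu : AEStronglyMeasurable (K.indicator u)) (huM : ∀ᵐ x, |K.indicator u x| ≤ M)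
    (hψ : ContDiff ℝ 2 ψ) (hc : HasCompactSupport ψ) (hψK : tsupport ψ ⊆ K) :
    ∫ x in Ω, (-(u x) * laplacian ψ x + |u x| ^ (q - 1) * u x * ψ x)
      = (∫ x, |K.indicator u x| ^ (q - 1) * K.indicator u x * ψ x)
        - ∫ x, K.indicator u x * laplacian ψ x := by
  have hout : ∀ x ∉ K, ψ x = 0 ∧ laplacian ψ x = 0 := fun x hx =>
    ⟨image_eq_zero_of_notMem_tsupport fun h => hx (hψK h),
      laplacian_eq_zero_of_notMem_tsupport fun h => hx (hψK h)⟩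
  have hmono := monotone_abs_rpow_mul_self hq
  have hfu : AEStronglyMeasurable fun x => |K.indicator u x| ^ (q - 1) * K.indicator u x :=
    (hmono.measurable.comp_aemeasurable hu.aemeasurable).aestronglyMeasurable
  have hfuM : ∀ᵐ x, |(|K.indicator u x| ^ (q - 1) * K.indicator u x)| ≤ |M| ^ (q - 1) * |M| := by
    filter_upwards [huM] with x hx
    have := hmono (hx.trans (le_abs_self M))
    simpa only [abs_mul, abs_abs, Real.abs_rpow_of_nonneg (abs_nonneg _)] using this
  have hi1 : Integrable fun x => |K.indicator u x| ^ (q - 1) * K.indicator u x * ψ x :=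
    (hψ.continuous.integrable_of_hasCompactSupport hc).bdd_mul hfu hfuM
  have hi2 : Integrable fun x => K.indicator u x * laplacian ψ x :=
    ((continuous_laplacian hψ).integrable_of_hasCompactSupport
      (hasCompactSupport_laplacian hc)).bdd_mul hu huM
  rw [setIntegral_eq_integral_of_forall_compl_eq_zero fun x hx => by
    simp [hout x fun h => hx (hKΩ h)], ← integral_sub hi1 hi2]
  refine integral_congr_ae (Eventually.of_forall fun x => ?_)
  by_cases hx : x ∈ K
  · simp only [indicator_of_mem hx]
    ring
  · simp [hout x hx]

lemma IsSubsolution.convolution_le_laplacian {N : ℕ} {q M : ℝ} (hq : 1 ≤ q)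
    {Ω K : Set (EuclideanSpace ℝ (Fin N))} {u : EuclideanSpace ℝ (Fin N) → ℝ}
    (hsub : IsSubsolution q Ω u) (hKΩ : K ⊆ Ω)
    (hu : AEStronglyMeasurable (K.indicator u)) (huM : ∀ᵐ x, |K.indicator u x| ≤ M)
    (ρ : ContDiffBump (0 : EuclideanSpace ℝ (Fin N))) {x : EuclideanSpace ℝ (Fin N)}
    (hx : Metric.closedBall x ρ.rOut ⊆ K) :
    (ρ.normed volume ⋆[lsmul ℝ ℝ, volume]
        fun y => |K.indicator u y| ^ (q - 1) * K.indicator u y) x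
      ≤ laplacian (ρ.normed volume ⋆[lsmul ℝ ℝ, volume] K.indicator u) x := by
  have hρ : ContDiff ℝ 2 (ρ.normed volume) := ρ.contDiff_normed (n := 2)
  have hψ : ContDiff ℝ (⊤ : ℕ∞) fun t => ρ.normed volume (x - t) :=
    ρ.contDiff_normed.comp (contDiff_const.sub contDiff_id)
  have hsupp : tsupport (fun t => ρ.normed volume (x - t)) ⊆ Metric.closedBall x ρ.rOut := by
    refine closure_minimal (fun t ht => ?_) Metric.isClosed_closedBall
    have : x - t ∈ Metric.ball 0 ρ.rOut := ρ.support_normed_eq (μ := volume) ▸ ht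
    rw [mem_ball_zero_iff, ← dist_eq_norm, dist_comm] at this
    exact this.le
  have hc : HasCompactSupport fun t => ρ.normed volume (x - t) :=
    (isCompact_closedBall x ρ.rOut).of_isClosed_subset (isClosed_tsupport _) hsupp
  have h := hsub.2 _ ⟨hψ, hc, hsupp.trans (hx.trans hKΩ)⟩ fun t => ρ.nonneg_normed _
  have hψ2 : ContDiff ℝ 2 fun t => ρ.normed volume (x - t) :=
    hρ.comp (contDiff_const.sub contDiff_id)
  rw [setIntegral_weakForm_eq hq hKΩ hu huM hψ2 hc (hsupp.trans hx), sub_nonpos] at h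
  rw [laplacian_convolution hρ ρ.hasCompactSupport_normed (locallyIntegrable_of_ae_abs_le hu huM),
    convolution_eq_swap]
  simpa only [laplacian_comp_const_sub hρ, ContinuousLinearMap.lsmul_apply, smul_eq_mul,
    mul_comm (ρ.normed volume _)] using h

lemma MemLinftyLoc.exists_ae_abs_indicator_le {N : ℕ} {Ω K : Set (EuclideanSpace ℝ (Fin N))}
    {u : EuclideanSpace ℝ (Fin N) → ℝ} (hu : MemLinftyLoc Ω u) (hKΩ : K ⊆ Ω) (hK : IsCompact K) :
    AEStronglyMeasurable (K.indicator u) ∧ ∃ M, ∀ᵐ x, |K.indicator u x| ≤ M := by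
  obtain ⟨M, hM⟩ := hu.2 K hKΩ hK
  refine ⟨(aestronglyMeasurable_indicator_iff hK.measurableSet).2 (hu.1.mono_set hKΩ),
    max M 0, ?_⟩
  filter_upwards [(ae_restrict_iff' hK.measurableSet).1 hM] with x hx
  by_cases hxK : x ∈ K
  · simpa [hxK] using Or.inl (hx hxK)
  · simp [hxK]

lemma MemLqLoc.max {N : ℕ} {q : ℝ} {Ω : Set (EuclideanSpace ℝ (Fin N))}
    {u v : EuclideanSpace ℝ (Fin N) → ℝ} (hu : MemLqLoc q Ω u) (hv : MemLqLoc q Ω v) :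
    MemLqLoc q Ω fun x => max (u x) (v x) := by
  have hm : AEStronglyMeasurable (fun x => Max.max (u x) (v x)) (volume.restrict Ω) :=
    hu.1.sup hv.1
  refine ⟨hm, fun K hKΩ hK => ?_⟩
  refine Integrable.mono' ((hu.2 K hKΩ hK).add (hv.2 K hKΩ hK))
    ((hm.mono_set hKΩ).aemeasurable.abs.pow_const q).aestronglyMeasurable
    (Eventually.of_forall fun x => ?_)
  have h1 : 0 ≤ |u x| ^ q := by positivity
  have h2 : 0 ≤ |v x| ^ q := by positivity
  rw [Real.norm_of_nonneg (by positivity)]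
  simp only [Pi.add_apply]
  rcases max_choice (u x) (v x) with h | h <;> rw [h] <;> linarith

theorem stmt4 {N : ℕ} (hN : 2 ≤ N) (q : ℝ) (hq : ((N : ℝ) + 1) / ((N : ℝ) - 1) ≤ q)
    (Ω : Set (EuclideanSpace ℝ (Fin N))) (hΩ : IsOpen Ω) (hΩne : Ω.Nonempty)
    (u v : EuclideanSpace ℝ (Fin N) → ℝ)
    (huloc : MemLinftyLoc Ω u) (hvloc : MemLinftyLoc Ω v)
    (hupos : ∀ᵐ x ∂(volume.restrict Ω), 0 ≤ u x)
    (hvpos : ∀ᵐ x ∂(volume.restrict Ω), 0 ≤ v x)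
    (husub : IsSubsolution q Ω u) (hvsub : IsSubsolution q Ω v) :
    IsSubsolution q Ω (fun x => max (u x) (v x)) := by
  have hq1 : 1 ≤ q := by
    have hN2 : (2 : ℝ) ≤ N := by exact_mod_cast hN
    refine le_trans ?_ hq
    rw [le_div_iff₀ (by linarith)]
    linarith
  refine ⟨husub.1.max hvsub.1, fun φ ⟨hφs, hc, hφΩ⟩ hφ0 => ?_⟩
  have hφ : ContDiff ℝ 2 φ := contDiff_infty.1 hφs 2
  obtain ⟨r, hr, hrΩ⟩ := hc.isCompact.exists_cthickening_subset_open hΩ hφΩ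
  have hK : IsCompact (Metric.cthickening r (tsupport φ)) := hc.isCompact.cthickening
  have hball : ∀ x ∈ tsupport φ, ∀ s ≤ r,
      Metric.closedBall x s ⊆ Metric.cthickening r (tsupport φ) := fun x hx s hs =>
    (Metric.closedBall_subset_closedBall hs).trans (Metric.closedBall_subset_cthickening hx r)
  have hsK : tsupport φ ⊆ Metric.cthickening r (tsupport φ) :=
    Metric.self_subset_cthickening _
  generalize Metric.cthickening r (tsupport φ) = K at hrΩ hK hball hsK
  obtain ⟨hum, M₁, hM₁⟩ := huloc.exists_ae_abs_indicator_le hrΩ hK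
  obtain ⟨hvm, M₂, hM₂⟩ := hvloc.exists_ae_abs_indicator_le hrΩ hK
  have huM : ∀ᵐ x, |K.indicator u x| ≤ max M₁ M₂ := hM₁.mono fun x hx => le_max_of_le_left hx
  have hvM : ∀ᵐ x, |K.indicator v x| ≤ max M₁ M₂ := hM₂.mono fun x hx => le_max_of_le_right hx
  have hind : K.indicator (fun x => max (u x) (v x))
      = fun x => max (K.indicator u x) (K.indicator v x) := by
    ext x
    by_cases hx : x ∈ K <;> simp [hx]
  have hmm : AEStronglyMeasurable (K.indicator fun x => max (u x) (v x)) :=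
    hind ▸ hum.sup hvm
  have hmM : ∀ᵐ x, |K.indicator (fun x => max (u x) (v x)) x| ≤ max M₁ M₂ := by
    filter_upwards [huM, hvM] with x h1 h2
    rw [hind]
    exact abs_max_le_max_abs_abs.trans (max_le h1 h2)
  rw [setIntegral_weakForm_eq hq1 hrΩ hmm hmM hφ hc hsK, hind, sub_nonpos]
  exact integral_comp_max_le_of_mollified (monotone_abs_rpow_mul_self hq1) hr hum hvm huM hvM hφ hc
    hφ0 (fun x hx ρ hρ => husub.convolution_le_laplacian hq1 hrΩ hum huM ρ (hball x hx _ hρ))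
    (fun x hx ρ hρ => hvsub.convolution_le_laplacian hq1 hrΩ hvm hvM ρ (hball x hx _ hρ))
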